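/- Suppose there is a constant c > 0 such that for every n ≥ 1, every finite alphabet B, and every finite incomplete set Y ⊆ B* whose words all have length at most n, Y has an incompletable word of length at most c·n². Then for every n ≥ 1, every finite alphabet A, and every finite complete synchronizing code X ⊆ A* whose words all have length at most n, X has a synchronizing pair (u,v) with |u·v| ≤ 2c·n² + 2n − 2. -/

import Mathlib

/-- The Kleene star of a set of words: the submonoid of the free monoid generated by `X`. -/
def Kstar {A : Type*} (X : Set (List A)) : Set (List A) :=
  {w | ∃ l : List (List A), (∀ x ∈ l, x ∈ X) ∧ l.flatten = w}

/-- `X` is complete: every word has an `X`-completion. -/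
def IsCompleteSet {A : Type*} (X : Set (List A)) : Prop :=
  ∀ w : List A, ∃ r s : List A, r ++ w ++ s ∈ Kstar X

/-- `(u, v)` is a synchronizing pair of `X`. -/
def IsSyncPair {A : Type*} (X : Set (List A)) (u v : List A) : Prop :=
  u ∈ Kstar X ∧ v ∈ Kstar X ∧
    ∀ r s : List A, r ++ (u ++ v) ++ s ∈ Kstar X →
      r ++ u ∈ Kstar X ∧ v ++ s ∈ Kstar X

/-- `X` is synchronizing: it has a synchronizing pair. -/
def IsSynchronizing {A : Type*} (X : Set (List A)) : Prop :=
  ∃ u v : List A, IsSyncPair X u v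

/-- `c` is a constant of `X`. -/
def IsConstant {A : Type*} (X : Set (List A)) (c : List A) : Prop :=
  c ∈ Kstar X ∧ ∀ u₁ u₂ u₃ u₄ : List A,
    u₁ ++ c ++ u₂ ∈ Kstar X → u₃ ++ c ++ u₄ ∈ Kstar X →
      u₁ ++ c ++ u₄ ∈ Kstar X ∧ u₃ ++ c ++ u₂ ∈ Kstar X

/-- `X` is a code: every word of `X*` has a unique factorization into words of `X`. -/
def IsCode {A : Type*} (X : Set (List A)) : Prop :=
  ∀ l₁ l₂ : List (List A), (∀ x ∈ l₁, x ∈ X) → (∀ x ∈ l₂, x ∈ X) →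
    l₁.flatten = l₂.flatten → l₁ = l₂

/-- `X` is a prefix code: no word of `X` is a proper prefix of another, and `X ≠ {ε}`. -/
def IsPrefixCode {A : Type*} (X : Set (List A)) : Prop :=
  (∀ x ∈ X, ∀ y ∈ X, x <+: y → x = y) ∧ X ≠ {([] : List A)}

/-- The monoid morphism `A* → B*` generated by the map `f` on letters. -/
def mlift {A B : Type*} (f : A → List B) : List A → List B :=
  fun w => (w.map f).flatten

section Kleene

variable {A : Type*} {X : Set (List A)}

theorem nil_mem_kstar : ([] : List A) ∈ Kstar X := ⟨[], by simp, rfl⟩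

theorem subset_kstar {x : List A} (hx : x ∈ X) : x ∈ Kstar X :=
  ⟨[x], by simpa using hx, by simp⟩

theorem append_mem_kstar {v w : List A} (hv : v ∈ Kstar X) (hw : w ∈ Kstar X) :
    v ++ w ∈ Kstar X := by
  obtain ⟨l, hl, rfl⟩ := hv
  obtain ⟨m, hm, rfl⟩ := hw
  refine ⟨l ++ m, ?_, by simp⟩
  intro x hx
  rcases List.mem_append.1 hx with h | h
  exacts [hl x h, hm x h]

theorem IsCode.nil_notMem (hX : IsCode X) : ([] : List A) ∉ X := by
  intro h
  have := hX [[]] [] (by simpa using h) (by simp) (by simp)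
  simp at this

/-- The submonoid generated by a code is stable. -/
theorem IsCode.stable (hX : IsCode X) {m w n : List A} (hm : m ∈ Kstar X) (hn : n ∈ Kstar X)
    (hmw : m ++ w ∈ Kstar X) (hwn : w ++ n ∈ Kstar X) : w ∈ Kstar X := by
  obtain ⟨lm, hlm, rfl⟩ := hm
  obtain ⟨ln, hln, rfl⟩ := hn
  obtain ⟨l₁, hl₁, h₁⟩ := hmw
  obtain ⟨l₂, hl₂, h₂⟩ := hwn
  have h := hX (lm ++ l₂) (l₁ ++ ln)
    (fun x hx => (List.mem_append.1 hx).elim (hlm x) (hl₂ x))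
    (fun x hx => (List.mem_append.1 hx).elim (hl₁ x) (hln x)) (by simp [h₁, h₂])
  rcases List.append_eq_append_iff.1 h with ⟨k, hk, -⟩ | ⟨k, hk, -⟩
  · subst hk
    refine ⟨k, fun x hx => hl₁ x (by simp [hx]), ?_⟩
    simpa using h₁
  · subst hk
    have : w = [] := by
      have := congrArg List.length h₁
      simp only [List.flatten_append, List.length_append] at this
      exact List.length_eq_zero_iff.1 (by omega)
    subst this
    exact nil_mem_kstar

/-- `(p, s)` is the pair of halves of a word of `X` cut at an interior position, or both halves
are empty. -/
def IsCrossing (X : Set (List A)) (p s : List A) : Prop :=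
  (p = [] ∧ s = []) ∨ (p ≠ [] ∧ s ≠ [] ∧ p ++ s ∈ X)

theorem IsCrossing.mem_kstar {p s : List A} (h : IsCrossing X p s) : p ++ s ∈ Kstar X := by
  rcases h with ⟨rfl, rfl⟩ | ⟨-, -, h⟩
  exacts [nil_mem_kstar, subset_kstar h]

theorem exists_isCrossing {w₁ w₂ : List A} (h : w₁ ++ w₂ ∈ Kstar X) :
    ∃ g p s k : List A, g ∈ Kstar X ∧ k ∈ Kstar X ∧ w₁ = g ++ p ∧ w₂ = s ++ k ∧
      IsCrossing X p s := by
  obtain ⟨l, hl, h⟩ := h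
  induction l generalizing w₁ with
  | nil =>
    obtain ⟨rfl, rfl⟩ : w₁ = [] ∧ w₂ = [] := by simpa using h.symm
    exact ⟨[], [], [], [], nil_mem_kstar, nil_mem_kstar, rfl, rfl, .inl ⟨rfl, rfl⟩⟩
  | cons x l ih =>
    have hx : x ∈ X := hl x (by simp)
    have hl' : ∀ y ∈ l, y ∈ X := fun y hy => hl y (by simp [hy])
    rw [List.flatten_cons] at h
    rcases List.append_eq_append_iff.1 h with ⟨c, rfl, h₂⟩ | ⟨c, rfl, h₂⟩
    · obtain ⟨g, p, s, k, hg, hk, rfl, rfl, hc⟩ := ih hl' h₂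
      exact ⟨x ++ g, p, s, k, append_mem_kstar (subset_kstar hx) hg, hk, by simp, rfl, hc⟩
    · have hflat : l.flatten ∈ Kstar X := ⟨l, hl', rfl⟩
      by_cases hw : w₁ = []
      · subst hw
        refine ⟨[], [], [], w₂, nil_mem_kstar, ?_, rfl, rfl, .inl ⟨rfl, rfl⟩⟩
        rw [h₂]
        exact append_mem_kstar (subset_kstar hx) hflat
      · by_cases hc : c = []
        · subst hc
          refine ⟨w₁, [], [], w₂, ?_, ?_, by simp, rfl, .inl ⟨rfl, rfl⟩⟩
          · exact subset_kstar (by simpa using hx)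
          · simpa [h₂] using hflat
        · exact ⟨[], w₁, c, l.flatten, nil_mem_kstar, hflat, rfl, h₂, .inr ⟨hw, hc, hx⟩⟩

theorem IsCode.cut_unique_aux (hX : IsCode X) {g p s g' p' s' : List A}
    {lg lk lg' lk' M M' m : List (List A)} (hlg : ∀ x ∈ lg, x ∈ X)
    (eg : lg.flatten = g) (eg' : lg'.flatten = g') (hl : g ++ p = g' ++ p')
    (eM : (M = [] ∧ p = [] ∧ s = []) ∨ (M = [p ++ s] ∧ s ≠ []))
    (eM' : (M' = [] ∧ p' = [] ∧ s' = []) ∨ (M' = [p' ++ s'] ∧ s' ≠ []))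
    (key : lg ++ (M ++ lk) = lg' ++ (M' ++ lk')) (hm : lg = lg' ++ m) :
    p = p' ∧ (s ≠ [] → s' ≠ [] → s = s') := by
  subst hm
  rw [List.append_assoc, List.append_cancel_left_eq] at key
  rw [List.flatten_append, eg'] at eg
  subst eg
  rw [List.append_assoc, List.append_cancel_left_eq] at hl
  cases m with
  | nil =>
    have hp : p = p' := by simpa using hl
    refine ⟨hp, fun hs hs' => ?_⟩
    rcases eM with ⟨-, -, h0⟩ | ⟨rfl, -⟩
    · exact absurd h0 hs
    rcases eM' with ⟨-, -, h0⟩ | ⟨rfl, -⟩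
    · exact absurd h0 hs'
    simp only [List.nil_append, List.cons_append, List.cons.injEq] at key
    have := key.1
    rw [hp, List.append_cancel_left_eq] at this
    exact this
  | cons y m =>
    exfalso
    have hy : y ∈ X := hlg y (by simp)
    rcases eM' with ⟨-, rfl, -⟩ | ⟨rfl, hs'⟩
    · have : y = [] := by simp at hl; exact hl.1
      exact hX.nil_notMem (this ▸ hy)
    · simp only [List.cons_append, List.nil_append, List.cons.injEq] at key
      have hlen := congrArg List.length hl
      rw [key.1] at hlen
      simp only [List.flatten_cons, List.length_append] at hlen
      exact hs' (List.length_eq_zero_iff.1 (by omega))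

/-- In a word generated by a code, the codeword straddling a given position is unique. -/
theorem IsCode.cut_unique (hX : IsCode X) {g p s k g' p' s' k' : List A}
    (hg : g ∈ Kstar X) (hk : k ∈ Kstar X) (hg' : g' ∈ Kstar X) (hk' : k' ∈ Kstar X)
    (hl : g ++ p = g' ++ p') (hr : s ++ k = s' ++ k')
    (h : (p = [] ∧ s = []) ∨ (s ≠ [] ∧ p ++ s ∈ X))
    (h' : (p' = [] ∧ s' = []) ∨ (s' ≠ [] ∧ p' ++ s' ∈ X)) :
    p = p' ∧ (s ≠ [] → s' ≠ [] → s = s') := by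
  have tot : ∀ {p s : List A}, (p = [] ∧ s = []) ∨ (s ≠ [] ∧ p ++ s ∈ X) →
      ∃ M : List (List A), (∀ x ∈ M, x ∈ X) ∧ M.flatten = p ++ s ∧
        ((M = [] ∧ p = [] ∧ s = []) ∨ (M = [p ++ s] ∧ s ≠ [])) := by
    rintro p s (⟨rfl, rfl⟩ | ⟨h1, h2⟩)
    · exact ⟨[], by simp, rfl, .inl ⟨rfl, rfl, rfl⟩⟩
    · exact ⟨[p ++ s], by simpa using h2, by simp, .inr ⟨rfl, h1⟩⟩
  obtain ⟨lg, hlg, eg⟩ := hg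
  obtain ⟨lk, hlk, ek⟩ := hk
  obtain ⟨lg', hlg', eg'⟩ := hg'
  obtain ⟨lk', hlk', ek'⟩ := hk'
  obtain ⟨M, hM, fM, eM⟩ := tot h
  obtain ⟨M', hM', fM', eM'⟩ := tot h'
  have key := hX (lg ++ (M ++ lk)) (lg' ++ (M' ++ lk'))
    (fun x hx => by
      rcases List.mem_append.1 hx with hx | hx
      · exact hlg x hx
      · exact (List.mem_append.1 hx).elim (hM x) (hlk x))
    (fun x hx => by
      rcases List.mem_append.1 hx with hx | hx
      · exact hlg' x hx
      · exact (List.mem_append.1 hx).elim (hM' x) (hlk' x))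
    (by
      simp only [List.flatten_append, fM, fM', eg, ek, eg', ek']
      calc g ++ (p ++ s ++ k) = (g ++ p) ++ (s ++ k) := by simp
        _ = (g' ++ p') ++ (s' ++ k') := by rw [hl, hr]
        _ = _ := by simp)
  rcases List.append_eq_append_iff.1 key with ⟨m, hm, -⟩ | ⟨m, hm, -⟩
  · obtain ⟨h1, h2⟩ := hX.cut_unique_aux hlg' eg' eg hl.symm eM' eM key.symm hm
    exact ⟨h1.symm, fun a b => (h2 b a).symm⟩
  · exact hX.cut_unique_aux hlg eg eg' hl eM eM' key hm

theorem IsCrossing.cut {p s : List A} (h : IsCrossing X p s) :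
    (p = [] ∧ s = []) ∨ (s ≠ [] ∧ p ++ s ∈ X) := h.imp id And.right

/-- The proper prefixes of words of `X` which can remain undecoded after reading `w`. -/
def residualPrefixes (X : Set (List A)) (w : List A) : Set (List A) :=
  {p | (∃ s, s ≠ [] ∧ p ++ s ∈ X) ∧ ∃ r g, g ∈ Kstar X ∧ r ++ w = g ++ p}

theorem IsCrossing.exists_prefix (hX : IsCode X) (hne : X.Nonempty) {p s : List A}
    (h : IsCrossing X p s) : ∃ t, t ≠ [] ∧ p ++ t ∈ X := by
  rcases h with ⟨rfl, -⟩ | ⟨-, hs, h⟩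
  · obtain ⟨x, hx⟩ := hne
    exact ⟨x, fun h => hX.nil_notMem (h ▸ hx), hx⟩
  · exact ⟨s, hs, h⟩

/-- Around a position flanked by two synchronizing contexts, the crossing is unique. -/
theorem IsSyncPair.crossing_unique (hX : IsCode X) {u v α β : List A} (huv : IsSyncPair X u v)
    {p s p' s' r g t k r' g' t' k' : List A}
    (hc : IsCrossing X p s) (hc' : IsCrossing X p' s')
    (hg : g ∈ Kstar X) (hk : k ∈ Kstar X) (hg' : g' ∈ Kstar X) (hk' : k' ∈ Kstar X)
    (hl : r ++ (u ++ v ++ α) = g ++ p) (hr : β ++ (u ++ v) ++ t = s ++ k)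
    (hl' : r' ++ (u ++ v ++ α) = g' ++ p') (hr' : β ++ (u ++ v) ++ t' = s' ++ k') :
    p = p' := by
  have ends : ∀ {p s r g t k : List A}, IsCrossing X p s → g ∈ Kstar X → k ∈ Kstar X →
      r ++ (u ++ v ++ α) = g ++ p → β ++ (u ++ v) ++ t = s ++ k →
      r ++ u ∈ Kstar X ∧ v ++ t ∈ Kstar X ∧ v ++ α ++ (β ++ u) ∈ Kstar X := by
    intro p s r g t k hc hg hk hl hr
    have htot : (r ++ (u ++ v ++ α)) ++ (β ++ (u ++ v) ++ t) ∈ Kstar X := by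
      rw [hl, hr]
      have := append_mem_kstar hg (append_mem_kstar hc.mem_kstar hk)
      simpa using this
    have h1 := huv.2.2 r (α ++ (β ++ (u ++ v) ++ t)) (by simpa using htot)
    have h2 := huv.2.2 (r ++ (u ++ v ++ α) ++ β) t (by simpa using htot)
    exact ⟨h1.1, h2.2, hX.stable h1.1 h2.2 (by simpa using h2.1) (by simpa using h1.2)⟩
  obtain ⟨h1, h2, hW⟩ := ends hc hg hk hl hr
  obtain ⟨h1', h2', -⟩ := ends hc' hg' hk' hl' hr'
  obtain ⟨G, P, S, K, hG, hK, eG, eK, hC⟩ := exists_isCrossing hW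
  have main : ∀ {p s r g t k : List A}, IsCrossing X p s → g ∈ Kstar X → k ∈ Kstar X →
      r ++ (u ++ v ++ α) = g ++ p → β ++ (u ++ v) ++ t = s ++ k →
      r ++ u ∈ Kstar X → v ++ t ∈ Kstar X → p = P := by
    intro p s r g t k hc hg hk hl hr h1 h2
    refine (hX.cut_unique (g' := r ++ u ++ G) (s' := S) (k' := K ++ (v ++ t)) hg hk
      (append_mem_kstar h1 hG) (append_mem_kstar hK h2) ?_ ?_ hc.cut hC.cut).1
    · simp [← hl, ← eG]
    · rw [← hr, ← List.append_assoc S, ← eK]; simp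
  rw [main hc hg hk hl hr h1 h2, main hc' hg' hk' hl' hr' h1' h2']

end Kleene

section Reverse

variable {A : Type*} {X : Set (List A)}

theorem reverse_mem_kstar {w : List A} (h : w ∈ Kstar (List.reverse ⁻¹' X)) :
    w.reverse ∈ Kstar X := by
  obtain ⟨l, hl, rfl⟩ := h
  refine ⟨(l.map List.reverse).reverse, ?_, by rw [List.reverse_flatten]⟩
  intro x hx
  simp only [List.mem_reverse, List.mem_map] at hx
  obtain ⟨y, hy, rfl⟩ := hx
  exact hl y hy

theorem mem_kstar_reverse_iff {w : List A} :
    w ∈ Kstar (List.reverse ⁻¹' X) ↔ w.reverse ∈ Kstar X := by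
  refine ⟨reverse_mem_kstar, fun h => ?_⟩
  have hXX : List.reverse ⁻¹' (List.reverse ⁻¹' X) = X := by ext; simp
  rw [← hXX] at h
  simpa using reverse_mem_kstar h

theorem IsCode.reverse (hX : IsCode X) : IsCode (List.reverse ⁻¹' X) := by
  intro l₁ l₂ h₁ h₂ h
  have key := hX (l₁.map List.reverse).reverse (l₂.map List.reverse).reverse
    (by
      intro x hx
      have := h₁ x.reverse (by simpa using hx)
      simpa using this)
    (by
      intro x hx
      have := h₂ x.reverse (by simpa using hx)
      simpa using this)
    (by rw [← List.reverse_flatten, ← List.reverse_flatten, h])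
  exact List.map_injective_iff.2 List.reverse_injective (List.reverse_injective key)

theorem IsCompleteSet.reverse (hX : IsCompleteSet X) : IsCompleteSet (List.reverse ⁻¹' X) := by
  intro w
  obtain ⟨r, s, h⟩ := hX w.reverse
  exact ⟨s.reverse, r.reverse, by rw [mem_kstar_reverse_iff]; simpa using h⟩

theorem IsSyncPair.reverse {u v : List A} (h : IsSyncPair X u v) :
    IsSyncPair (List.reverse ⁻¹' X) v.reverse u.reverse := by
  obtain ⟨hu, hv, h⟩ := h
  refine ⟨by simpa [mem_kstar_reverse_iff] using hv, by simpa [mem_kstar_reverse_iff] using hu,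
    fun r s hrs => ?_⟩
  rw [mem_kstar_reverse_iff] at hrs
  have := h s.reverse r.reverse (by simpa using hrs)
  simp only [mem_kstar_reverse_iff]
  exact ⟨by simpa using this.2, by simpa using this.1⟩

end Reverse

section Marked

variable {A : Type*} {X : Set (List A)} (a : A)

/-- Replace the marked letter `none` by `a`. -/
def unmark (w : List (Option A)) : List A := w.map (Option.getD · a)

@[simp] theorem unmark_append (v w : List (Option A)) :
    unmark a (v ++ w) = unmark a v ++ unmark a w := by simp [unmark]

@[simp] theorem unmark_nil : unmark a [] = [] := rfl

@[simp] theorem unmark_cons (o : Option A) (w : List (Option A)) :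
    unmark a (o :: w) = o.getD a :: unmark a w := rfl

@[simp] theorem unmark_map_some (w : List A) : unmark a (w.map some) = w := by
  simp [unmark, Function.comp_def]

@[simp] theorem length_unmark (w : List (Option A)) : (unmark a w).length = w.length := by
  simp [unmark]

/-- Words of `X` with some letters `a` marked, where the last letter of `p₀ ++ [a]` may not be
marked, together with the words ended by a mark after a proper prefix of `X` outside of `I`. -/
def markedSet (X : Set (List A)) (p₀ : List A) (I : Set (List A)) : Set (List (Option A)) :=
  {y | unmark a y ∈ X ∧ ∀ y', y = y' ++ [none] → unmark a y' ≠ p₀} ∪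
  {y | ∃ y', y = y' ++ [none] ∧ (∃ s, s ≠ [] ∧ unmark a y' ++ s ∈ X) ∧ unmark a y' ∉ I}

variable {a} {p₀ : List A} {I : Set (List A)}

theorem length_le_of_mem_markedSet {n : ℕ} (hn : ∀ w ∈ X, w.length ≤ n) {y : List (Option A)}
    (hy : y ∈ markedSet a X p₀ I) : y.length ≤ n := by
  rcases hy with ⟨hy, -⟩ | ⟨y', rfl, ⟨s, hs, hy⟩, -⟩
  · simpa using hn _ hy
  · have h1 := hn _ hy
    have h2 := List.length_pos_iff.2 hs
    simp at h1 ⊢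
    omega

theorem unmark_mem_of_mem_markedSet {y c : List (Option A)} {e : List A} (he : e ≠ [])
    (hy : y ∈ markedSet a X p₀ I) (h : y = c ++ e.map some) : unmark a y ∈ X := by
  rcases hy with ⟨hy, -⟩ | ⟨y', rfl, -, -⟩
  · exact hy
  · exfalso
    obtain ⟨e, b, rfl⟩ := List.eq_nil_or_concat e |>.resolve_left he
    have := congrArg List.getLast? h
    simp at this

theorem exists_append_mem_of_mem_markedSet {y c : List (Option A)} {e : List A} (he : e ≠ [])
    (hy : y ∈ markedSet a X p₀ I) (h : y = e.map some ++ c) : ∃ s, e ++ s ∈ X := by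
  rcases hy with ⟨hy, -⟩ | ⟨y', rfl, ⟨s, -, hs⟩, -⟩
  · exact ⟨unmark a c, by simpa [h] using hy⟩
  · rcases List.eq_nil_or_concat c with rfl | ⟨c', b, rfl⟩
    · exfalso
      obtain ⟨e, b, rfl⟩ := List.eq_nil_or_concat e |>.resolve_left he
      have := congrArg List.getLast? h
      simp at this
    · have : y' = e.map some ++ c' := by
        have := congrArg List.dropLast h
        simpa [← List.append_assoc] using this
      subst this
      exact ⟨unmark a c' ++ s, by simpa using hs⟩

theorem exists_left_completion_of_markedSet {z : List A} {P G : List (Option A)}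
    (hG : G ∈ Kstar (markedSet a X p₀ I)) (h : P ++ z.map some = G) :
    ∃ r g, g ∈ Kstar X ∧ r ++ z = g := by
  obtain ⟨l, hl, rfl⟩ := hG
  induction l using List.reverseRecOn generalizing z with
  | nil =>
    have : z = [] := by simp at h; exact h.2
    exact ⟨[], [], nil_mem_kstar, by simp [this]⟩
  | append_singleton l y ih =>
    by_cases hz : z = []
    · exact ⟨[], [], nil_mem_kstar, by simp [hz]⟩
    have hy : y ∈ markedSet a X p₀ I := hl y (by simp)
    have hl' : ∀ x ∈ l, x ∈ markedSet a X p₀ I := fun x hx => hl x (by simp [hx])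
    simp only [List.flatten_append, List.flatten_cons, List.flatten_nil, List.append_nil] at h
    rcases List.append_eq_append_iff.1 h with ⟨c, h1, h2⟩ | ⟨c, h1, h2⟩
    · obtain ⟨z₁, z₂, rfl, rfl, rfl⟩ := List.map_eq_append_iff.1 h2
      obtain ⟨r, g, hg, hr⟩ := ih hl' h1.symm
      by_cases hz₂ : z₂ = []
      · exact ⟨r, g, hg, by simpa [hz₂] using hr⟩
      · have := unmark_mem_of_mem_markedSet (c := []) hz₂ hy rfl
        rw [unmark_map_some] at this
        exact ⟨r, g ++ z₂, append_mem_kstar hg (subset_kstar this), by simp [← hr]⟩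
    · have := unmark_mem_of_mem_markedSet hz hy h2
      rw [h2] at this
      exact ⟨unmark a c, _, subset_kstar this, by simp⟩

theorem exists_right_completion_of_markedSet {z : List A} {S K : List (Option A)}
    (hK : K ∈ Kstar (markedSet a X p₀ I)) (h : z.map some ++ S = K) :
    ∃ s k, k ∈ Kstar X ∧ z ++ s = k := by
  obtain ⟨l, hl, rfl⟩ := hK
  induction l generalizing z with
  | nil =>
    have : z = [] := by simp at h; exact h.1
    exact ⟨[], [], nil_mem_kstar, by simp [this]⟩
  | cons y l ih =>
    by_cases hz : z = []
    · exact ⟨[], [], nil_mem_kstar, by simp [hz]⟩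
    have hy : y ∈ markedSet a X p₀ I := hl y (by simp)
    have hl' : ∀ x ∈ l, x ∈ markedSet a X p₀ I := fun x hx => hl x (by simp [hx])
    rw [List.flatten_cons] at h
    rcases List.append_eq_append_iff.1 h with ⟨c, h1, h2⟩ | ⟨c, h1, h2⟩
    · obtain ⟨s, hs⟩ := exists_append_mem_of_mem_markedSet hz hy h1
      exact ⟨s, _, subset_kstar hs, rfl⟩
    · obtain ⟨z₁, z₂, rfl, rfl, rfl⟩ := List.map_eq_append_iff.1 h1
      obtain ⟨s, k, hk, hs⟩ := ih hl' h2.symm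
      by_cases hz₁ : z₁ = []
      · exact ⟨s, k, hk, by simpa [hz₁] using hs⟩
      · have := unmark_mem_of_mem_markedSet (c := []) hz₁ hy rfl
        rw [unmark_map_some] at this
        exact ⟨s, z₁ ++ k, append_mem_kstar (subset_kstar this) hk, by simp [← hs]⟩

/-- If no synchronization occurs before a mark of `w`, every residual prefix of the underlying
word can still be reached by decoding with the marked set. -/
theorem exists_marked_residual (hX : IsCode X) {w : List (Option A)}
    (hw : ∀ w₀ w₁, w = w₀ ++ none :: w₁ → ¬ residualPrefixes X (unmark a w₀) ⊆ I)
    {p : List A} (hp : p ∈ residualPrefixes X (unmark a w)) :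
    ∃ P G y, G ∈ Kstar (markedSet a X p₀ I) ∧ P ++ w = G ++ y ∧ unmark a y = p := by
  induction w using List.reverseRecOn generalizing p with
  | nil => exact ⟨p.map some, [], p.map some, nil_mem_kstar, by simp, by simp⟩
  | append_singleton w o ih =>
    have hw' : ∀ w₀ w₁, w = w₀ ++ none :: w₁ → ¬ residualPrefixes X (unmark a w₀) ⊆ I := by
      rintro w₀ w₁ rfl
      exact hw w₀ (w₁ ++ [o]) (by simp)
    obtain ⟨⟨s, hs, hps⟩, r, g, hg, h⟩ := hp
    simp only [unmark_append, unmark_cons, unmark_nil] at h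
    rw [← List.append_assoc] at h
    rcases List.eq_nil_or_concat p with rfl | ⟨p', b, rfl⟩
    · cases o with
      | none =>
        obtain ⟨q, hq, hqI⟩ := Set.not_subset.1 (hw w [] rfl)
        obtain ⟨P, G, y, hG, hP, hy⟩ := ih hw' hq
        refine ⟨P, G ++ (y ++ [none]), [], append_mem_kstar hG (subset_kstar ?_), ?_, rfl⟩
        · exact .inr ⟨y, rfl, hy ▸ hq.1, hy ▸ hqI⟩
        · rw [← List.append_assoc, hP]; simp
      | some b =>
        obtain ⟨l, hl, rfl⟩ := hg
        rcases List.eq_nil_or_concat l with rfl | ⟨l, x, rfl⟩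
        · simp at h
        have hx : x ∈ X := hl x (by simp)
        rcases List.eq_nil_or_concat x with rfl | ⟨x, b', rfl⟩
        · exact absurd hx hX.nil_notMem
        have h' : (r ++ unmark a w) ++ [b] = (l.flatten ++ x) ++ [b'] := by simpa using h
        obtain ⟨h1, h2⟩ := List.append_inj' h' rfl
        obtain rfl : b = b' := by simpa using h2
        rw [List.concat_eq_append] at hx
        obtain ⟨P, G, y, hG, hP, hy⟩ := ih hw' (p := x)
          ⟨⟨[b], by simp, hx⟩, r, l.flatten, ⟨l, fun z hz => hl z (by simp [hz]), rfl⟩, h1⟩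
        refine ⟨P, G ++ (y ++ [some b]), [], append_mem_kstar hG (subset_kstar ?_), ?_, rfl⟩
        · refine .inl ⟨by simpa [hy] using hx, fun y' hy' => ?_⟩
          have := congrArg List.getLast? hy'
          simp at this
        · rw [← List.append_assoc, hP]; simp
    · rw [List.concat_eq_append, ← List.append_assoc] at h
      obtain ⟨h1, h2⟩ := List.append_inj' h rfl
      have hb : o.getD a = b := by simpa using h2
      obtain ⟨P, G, y, hG, hP, hy⟩ := ih hw' (p := p')
        ⟨⟨b :: s, by simp, by simpa using hps⟩, r, g, hg, h1⟩
      exact ⟨P, G, y ++ [o], hG, by rw [← List.append_assoc, hP]; simp, by simp [hy, hb]⟩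

theorem exists_completion_markedSet (hX : IsCode X) (hne : X.Nonempty) (hcomp : IsCompleteSet X)
    {w : List (Option A)}
    (hw : ∀ w₀ w₁, w = w₀ ++ none :: w₁ → ¬ residualPrefixes X (unmark a w₀) ⊆ I) :
    ∃ P S, P ++ w ++ S ∈ Kstar (markedSet a X p₀ I) := by
  obtain ⟨r, s, hrs⟩ := hcomp (unmark a w)
  obtain ⟨g, p, t, k, hg, -, h1, -, hc⟩ := exists_isCrossing hrs
  obtain ⟨t', ht', hpt⟩ := hc.exists_prefix hX hne
  obtain ⟨P, G, y, hG, hP, hy⟩ :=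
    exists_marked_residual (p₀ := p₀) hX hw ⟨⟨t', ht', hpt⟩, r, g, hg, h1⟩
  refine ⟨P, t'.map some, ?_⟩
  rw [hP, List.append_assoc]
  refine append_mem_kstar hG (subset_kstar (.inl ⟨by simpa [hy] using hpt, fun y' hy' => ?_⟩))
  obtain ⟨e, b, rfl⟩ := List.eq_nil_or_concat t' |>.resolve_left ht'
  have := congrArg List.getLast? hy'
  simp [← List.append_assoc] at this

theorem not_isCompleteSet_markedSet (hX : IsCode X) {u v : List A} (huv : IsSyncPair X u v)
    (hx : p₀ ++ [a] ∈ X) :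
    ¬ IsCompleteSet (markedSet a X p₀ (residualPrefixes X (u ++ v ++ p₀))) := by
  set Y := markedSet a X p₀ (residualPrefixes X (u ++ v ++ p₀)) with hY
  intro hcomp
  obtain ⟨P, S, hPS⟩ := hcomp ((u ++ v ++ p₀).map some ++ none :: (u ++ v).map some)
  obtain ⟨G, y₁, y, K, hG, hK, eG, eK, hc⟩ : ∃ G y₁ y₂ K, G ∈ Kstar Y ∧ K ∈ Kstar Y ∧
      P ++ (u ++ v ++ p₀).map some = G ++ y₁ ∧ (u ++ v).map some ++ S = y₂ ++ K ∧
      y₁ ++ none :: y₂ ∈ Y := by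
    have h0 : (P ++ (u ++ v ++ p₀).map some) ++ none :: ((u ++ v).map some ++ S) ∈ Kstar Y := by
      simpa using hPS
    obtain ⟨l, hl, h⟩ := h0
    obtain ⟨l₁, y₁, y₂, l₂, rfl, h1, h2⟩ : ∃ l₁ y₁ y₂ l₂, l = l₁ ++ (y₁ ++ none :: y₂) :: l₂ ∧
        P ++ (u ++ v ++ p₀).map some = l₁.flatten ++ y₁ ∧
        (u ++ v).map some ++ S = y₂ ++ l₂.flatten := by
      generalize P ++ (u ++ v ++ p₀).map some = q at h
      generalize (u ++ v).map some ++ S = q' at h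
      clear hl
      induction l generalizing q with
      | nil => simp at h
      | cons x l ih =>
        rw [List.flatten_cons] at h
        rcases List.append_eq_append_iff.1 h with ⟨c, rfl, h2⟩ | ⟨c, rfl, h2⟩
        · obtain ⟨l₁, y₁, y₂, l₂, rfl, rfl, rfl⟩ := ih c h2
          exact ⟨x :: l₁, y₁, y₂, l₂, rfl, by simp, rfl⟩
        · cases c with
          | nil =>
            obtain ⟨l₁, y₁, y₂, l₂, rfl, h3, rfl⟩ := ih [] (by simpa using h2.symm)
            exact ⟨q :: l₁, y₁, y₂, l₂, by simp, by simpa using h3, rfl⟩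
          | cons o c =>
            simp only [List.cons_append, List.cons.injEq] at h2
            obtain ⟨rfl, rfl⟩ := h2
            exact ⟨[], q, c, l, rfl, rfl, rfl⟩
    exact ⟨l₁.flatten, y₁, y₂, l₂.flatten, ⟨l₁, fun x hx => hl x (by simp [hx]), rfl⟩,
      ⟨l₂, fun x hx => hl x (by simp [hx]), rfl⟩, h1, h2, hl _ (by simp)⟩
  obtain ⟨r, g, hg, hrg⟩ : ∃ r g, g ∈ Kstar X ∧ r ++ (u ++ v ++ p₀) = g ++ unmark a y₁ := by
    rcases List.append_eq_append_iff.1 eG with ⟨c, h1, h2⟩ | ⟨c, h1, h2⟩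
    · obtain ⟨z₁, z₂, h3, rfl, rfl⟩ := List.map_eq_append_iff.1 h2
      obtain ⟨r, g, hg, hr⟩ := exists_left_completion_of_markedSet hG h1.symm
      exact ⟨r, g, hg, by rw [h3, ← hr]; simp⟩
    · exact ⟨unmark a c, [], nil_mem_kstar, by rw [h2]; simp⟩
  obtain ⟨e, t, k, hk, hmem, ht, hne⟩ : ∃ e t k, k ∈ Kstar X ∧ unmark a y₁ ++ a :: e ∈ X ∧
      u ++ v ++ t = e ++ k ∧ ¬ (unmark a y₁ = p₀ ∧ e = []) := by
    rcases hc with ⟨hc, hc'⟩ | ⟨y', hy', ⟨s, hs, hmem⟩, hI⟩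
    · have hne : ¬ (unmark a y₁ = p₀ ∧ unmark a y = []) := by
        rintro ⟨h1, h2⟩
        obtain rfl : y = [] := by simpa [unmark] using h2
        exact hc' y₁ rfl h1
      rcases List.append_eq_append_iff.1 eK with ⟨c, h1, h2⟩ | ⟨c, h1, h2⟩
      · exact ⟨unmark a y, unmark a c, [], nil_mem_kstar, by simpa using hc, by simp [h1], hne⟩
      · obtain ⟨z₁, z₂, h3, rfl, rfl⟩ := List.map_eq_append_iff.1 h1
        obtain ⟨t, k, hk, htk⟩ := exists_right_completion_of_markedSet hK h2.symm
        exact ⟨z₁, t, k, hk, by simpa using hc, by rw [h3, ← htk]; simp, by simpa using hne⟩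
    · rcases List.eq_nil_or_concat y with rfl | ⟨y₂, o, rfl⟩
      · obtain rfl : y₁ = y' := by simpa using hy'
        exact absurd ⟨⟨s, hs, hmem⟩, r, g, hg, hrg⟩ hI
      · have hy'' : (y₁ ++ none :: y₂) ++ [o] = y' ++ [none] := by simpa using hy'
        obtain ⟨rfl, ho⟩ := List.append_inj' hy'' rfl
        obtain rfl : o = none := by simpa using ho
        have : ∃ c, y₂ = (u ++ v).map some ++ c := by
          rw [List.concat_eq_append, List.append_assoc] at eK
          rcases List.append_eq_append_iff.1 eK with ⟨c, h1, -⟩ | ⟨c, h1, h2⟩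
          · exact ⟨c, h1⟩
          · obtain ⟨z₁, z₂, -, -, rfl⟩ := List.map_eq_append_iff.1 h1
            cases z₂ with
            | nil => exact ⟨[], by simpa using h1.symm⟩
            | cons b z₂ => simp at h2
        obtain ⟨c, rfl⟩ := this
        exact ⟨u ++ v ++ unmark a c ++ s, unmark a c ++ s, [], nil_mem_kstar,
          by simpa using hmem, by simp, by simp [hs]⟩
  have htot : r ++ (u ++ v ++ p₀) ++ (a :: (u ++ v ++ t)) ∈ Kstar X := by
    rw [hrg, ht]
    have := append_mem_kstar hg (append_mem_kstar (subset_kstar hmem) hk)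
    simpa using this
  have h1 := (huv.2.2 r (p₀ ++ a :: (u ++ v ++ t)) (by simpa using htot)).1
  have h2 := (huv.2.2 (r ++ (u ++ v ++ p₀) ++ [a]) t (by simpa using htot)).2
  have key := hX.cut_unique (g := r ++ u ++ v) (p := p₀) (s := [a]) (k := u ++ (v ++ t))
    (g' := g) (p' := unmark a y₁) (s' := a :: e) (k' := k) (append_mem_kstar h1 huv.2.1)
    (append_mem_kstar huv.1 h2) hg hk (by simpa using hrg) (by simpa using ht)
    (.inr ⟨by simp, hx⟩) (.inr ⟨by simp, hmem⟩)
  have he := key.2 (by simp) (by simp)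
  exact hne ⟨key.1.symm, by simpa using he.symm⟩

end Marked

/-- Under Restivo's conjecture there is a word of quadratic length whose residual prefixes are
among those of `u ++ v ++ α`, for a given synchronizing pair `(u, v)` and some word `α`. -/
theorem exists_residualPrefixes_subset {c : ℝ}
    (H : ∀ n : ℕ, 1 ≤ n → ∀ (B : Type) [Fintype B], ∀ Y : Set (List B),
      Y.Finite → (∀ w ∈ Y, w.length ≤ n) → ¬ IsCompleteSet Y →
      ∃ w : List B, (∀ p s : List B, p ++ w ++ s ∉ Kstar Y) ∧ (w.length : ℝ) ≤ c * n ^ 2)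
    {n : ℕ} (hn : 1 ≤ n) {A : Type} [Fintype A] {X : Set (List A)} (hlen : ∀ w ∈ X, w.length ≤ n)
    (hX : IsCode X) (hcomp : IsCompleteSet X) (hne : X.Nonempty) {u v : List A}
    (huv : IsSyncPair X u v) :
    ∃ α w : List A, (w.length : ℝ) ≤ c * n ^ 2 ∧
      residualPrefixes X w ⊆ residualPrefixes X (u ++ v ++ α) := by
  obtain ⟨x, hx⟩ := hne
  rcases List.eq_nil_or_concat x with rfl | ⟨p₀, a, rfl⟩
  · exact absurd hx hX.nil_notMem
  rw [List.concat_eq_append] at hx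
  have hlenY := fun y hy => length_le_of_mem_markedSet
    (a := a) (p₀ := p₀) (I := residualPrefixes X (u ++ v ++ p₀)) (y := y) hlen hy
  obtain ⟨w, hw, hwlen⟩ := H n hn (Option A) _
    ((List.finite_length_le (Option A) n).subset hlenY) hlenY
    (not_isCompleteSet_markedSet hX huv hx)
  by_contra hcon
  push Not at hcon
  obtain ⟨P, S, hPS⟩ := exists_completion_markedSet (a := a) (p₀ := p₀)
    (I := residualPrefixes X (u ++ v ++ p₀)) (w := w) hX ⟨_, hx⟩ hcomp (by
      rintro w₀ w₁ rfl
      refine hcon p₀ _ (le_trans ?_ hwlen)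
      simp only [length_unmark, List.length_append, List.length_cons]
      push_cast
      linarith [(Nat.cast_nonneg w₁.length : (0 : ℝ) ≤ w₁.length)])
  exact hw P S hPS

/-- If Restivo's conjecture holds with constant `c` (every finite incomplete set of size at
most `n` has an incompletable word of length at most `c·n²`), then every finite complete
synchronizing code of size at most `n` has a synchronizing pair of length at most
`2·c·n² + 2n - 2`. -/
theorem syncPair_quadratic_of_restivo (c : ℝ) (hc : 0 < c)
    (H : ∀ n : ℕ, 1 ≤ n → ∀ (B : Type) [Fintype B], ∀ Y : Set (List B),
      Y.Finite → (∀ w ∈ Y, w.length ≤ n) → ¬ IsCompleteSet Y →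
      ∃ w : List B, (∀ p s : List B, p ++ w ++ s ∉ Kstar Y) ∧ (w.length : ℝ) ≤ c * n ^ 2) :
    ∀ n : ℕ, 1 ≤ n → ∀ (A : Type) [Fintype A], ∀ X : Set (List A),
      X.Finite → (∀ w ∈ X, w.length ≤ n) → IsCode X → IsCompleteSet X → IsSynchronizing X →
      ∃ u v : List A, IsSyncPair X u v ∧
        ((u ++ v).length : ℝ) ≤ 2 * c * n ^ 2 + 2 * n - 2 := by
  intro n hn A _ X hfin hlen hX hcomp hsync
  have hn' : (1 : ℝ) ≤ n := by exact_mod_cast hn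
  rcases X.eq_empty_or_nonempty with rfl | hne
  · refine ⟨[], [], ⟨nil_mem_kstar, nil_mem_kstar, ?_⟩, ?_⟩
    · rintro r s ⟨l, hl, h⟩
      obtain rfl : l = [] := List.eq_nil_iff_forall_not_mem.2 hl
      obtain ⟨rfl, rfl⟩ : r = [] ∧ s = [] := by simpa using h.symm
      exact ⟨nil_mem_kstar, nil_mem_kstar⟩
    · have : 0 ≤ 2 * c * (n : ℝ) ^ 2 := by positivity
      simp only [List.append_nil, List.length_nil, Nat.cast_zero]
      linarith
  obtain ⟨u, v, huv⟩ := hsync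
  obtain ⟨α, w₁, hw₁, hsub₁⟩ := exists_residualPrefixes_subset H hn hlen hX hcomp hne huv
  have hne' : (List.reverse ⁻¹' X).Nonempty := by
    obtain ⟨x, hx⟩ := hne
    exact ⟨x.reverse, by simpa using hx⟩
  obtain ⟨β, w₂, hw₂, hsub₂⟩ := exists_residualPrefixes_subset H hn
    (X := List.reverse ⁻¹' X) (fun w hw => by simpa using hlen _ hw) hX.reverse hcomp.reverse
    hne' huv.reverse
  have left : ∀ {p s r g : List A}, IsCrossing X p s → g ∈ Kstar X → r ++ w₁ = g ++ p →
      ∃ r' g', g' ∈ Kstar X ∧ r' ++ (u ++ v ++ α) = g' ++ p := by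
    intro p s r g hc hg h
    exact (hsub₁ ⟨hc.exists_prefix hX hne, r, g, hg, h⟩).2
  have right : ∀ {p s t k : List A}, IsCrossing X p s → k ∈ Kstar X →
      w₂.reverse ++ t = s ++ k →
      ∃ t' k', k' ∈ Kstar X ∧ β.reverse ++ (u ++ v) ++ t' = s ++ k' := by
    intro p s t k hc hk h
    have hc' : IsCrossing (List.reverse ⁻¹' X) s.reverse p.reverse := by
      rcases hc with ⟨rfl, rfl⟩ | ⟨h1, h2, h3⟩
      · exact .inl ⟨rfl, rfl⟩
      · exact .inr ⟨by simpa using h2, by simpa using h1, by simpa using h3⟩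
    obtain ⟨-, r, g, hg, hr⟩ := hsub₂ ⟨hc'.exists_prefix hX.reverse hne', t.reverse, k.reverse,
      by simpa [mem_kstar_reverse_iff] using hk, by simpa using congrArg List.reverse h⟩
    exact ⟨r.reverse, g.reverse, reverse_mem_kstar hg, by simpa using congrArg List.reverse hr⟩
  have short : ∀ {p s : List A}, IsCrossing X p s → p.length + 1 ≤ n ∧ s.length + 1 ≤ n := by
    rintro p s (⟨rfl, rfl⟩ | ⟨h1, h2, h3⟩)
    · simpa using hn
    · have := hlen _ h3
      have := List.length_pos_iff.2 h1
      have := List.length_pos_iff.2 h2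
      simp at *
      omega
  obtain ⟨R, S, hR, hS, hRS⟩ : ∃ R S : List A, R.length + 1 ≤ n ∧ S.length + 1 ≤ n ∧
      (R ++ w₁) ++ (w₂.reverse ++ S) ∈ Kstar X := by
    obtain ⟨r, s, hrs⟩ := hcomp (w₁ ++ w₂.reverse)
    rw [List.append_assoc] at hrs
    obtain ⟨g, p, t, k, -, hk, -, h2, hc⟩ := exists_isCrossing hrs
    have h3 : (p ++ (w₁ ++ w₂.reverse)) ++ s ∈ Kstar X := by
      rw [List.append_assoc, h2, ← List.append_assoc]
      exact append_mem_kstar hc.mem_kstar hk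
    obtain ⟨g', p', t', k', hg', -, h4, -, hc'⟩ := exists_isCrossing h3
    refine ⟨p, t', (short hc).1, (short hc').2, ?_⟩
    have h5 : (p ++ (w₁ ++ w₂.reverse)) ++ t' ∈ Kstar X := by
      rw [h4, List.append_assoc]
      exact append_mem_kstar hg' hc'.mem_kstar
    simpa using h5
  obtain ⟨g, p, s, k, hg, hk, h1, h2, hc⟩ := exists_isCrossing hRS
  have hmid : g ++ (p ++ (w₂.reverse ++ S)) = R ++ w₁ ++ (w₂.reverse ++ S) := by
    rw [h1]; simp
  refine ⟨g, p ++ (w₂.reverse ++ S), ⟨hg, ?_, fun r' s' h => ?_⟩, ?_⟩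
  · rw [h2, ← List.append_assoc]
    exact append_mem_kstar hc.mem_kstar hk
  · rw [hmid] at h
    have h' : (r' ++ R ++ w₁) ++ (w₂.reverse ++ (S ++ s')) ∈ Kstar X := by simpa using h
    obtain ⟨g', p', t, k', hg', hk', h3, h4, hc'⟩ := exists_isCrossing h'
    obtain ⟨a₁, a₂, ha, ha'⟩ := left hc hg h1
    obtain ⟨b₁, b₂, hb, hb'⟩ := right hc hk h2
    obtain ⟨a₃, a₄, hd, hd'⟩ := left hc' hg' h3
    obtain ⟨b₃, b₄, he, he'⟩ := right hc' hk' h4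
    obtain rfl : p = p' := huv.crossing_unique hX hc hc' ha hb hd he ha' hb' hd' he'
    constructor
    · have : r' ++ g ++ p = g' ++ p := by rw [← h3, List.append_assoc, ← h1]; simp
      rw [List.append_cancel_right_eq] at this
      rwa [this]
    · have : p ++ (w₂.reverse ++ S) ++ s' = (p ++ t) ++ k' := by
        rw [List.append_assoc p t, ← h4]; simp
      rw [this]
      exact append_mem_kstar hc'.mem_kstar hk'
  · rw [hmid]
    have hR' : (R.length : ℝ) + 1 ≤ n := by exact_mod_cast hR
    have hS' : (S.length : ℝ) + 1 ≤ n := by exact_mod_cast hS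
    simp only [List.length_append, List.length_reverse]
    push_cast
    linarith
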